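/- Let T = X + iY satisfy assumption (A) and let α, ψ, φ, β be polynomials with complex coefficients. Then [α(X)ψ(Y), φ(X)β(Y)] − ([α(X)(ψβ)(Y), φ(X)] + [(αφ)(X)ψ(Y), β(Y)]) is trace class with trace zero; consequently −i Tr([α(X)ψ(Y), φ(X)β(Y)]) = −i Tr([α(X)(ψβ)(Y), φ(X)]) − i Tr([(αφ)(X)ψ(Y), β(Y)]), and (Wallach-type collapse) −i Tr([α(X)ψ(Y), φ(X)β(Y)]) = ∫_{[a,b]²} −J(αψ, φβ)(t, λ) r(t, λ) dt dλ. -/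

import Mathlib

open scoped InnerProductSpace
open MeasureTheory Polynomial

namespace HHCP

variable {H : Type*} [NormedAddCommGroup H] [InnerProductSpace ℂ H] [CompleteSpace H]
  [TopologicalSpace.SeparableSpace H]

/-- `f(A)` for a function `f` of a real variable, applied to the (selfadjoint, hence
star-normal) bounded operator `A` via the continuous functional calculus. -/
noncomputable def fc (f : ℝ → ℂ) (A : H →L[ℂ] H) : H →L[ℂ] H :=
  cfc (fun z : ℂ => f z.re) A

/-- `|A| = √(A⋆A)`. -/
noncomputable def absOp (A : H →L[ℂ] H) : H →L[ℂ] H :=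
  cfc Real.sqrt (ContinuousLinearMap.adjoint A * A)

/-- `A` is of trace class, i.e. `∑ ⟪eᵢ, |A| eᵢ⟫ < ∞` (this is independent of the
choice of the Hilbert basis `e`). -/
def IsTraceClass {ι : Type*} (e : HilbertBasis ι ℂ H) (A : H →L[ℂ] H) : Prop :=
  Summable fun i => (⟪e i, absOp A (e i)⟫_ℂ).re

/-- The trace norm `‖A‖₁ = Tr |A|`. -/
noncomputable def traceNorm {ι : Type*} (e : HilbertBasis ι ℂ H) (A : H →L[ℂ] H) : ℝ :=
  ∑' i, (⟪e i, absOp A (e i)⟫_ℂ).re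

/-- The trace `Tr A = ∑ᵢ ⟪eᵢ, A eᵢ⟫`. -/
noncomputable def trace {ι : Type*} (e : HilbertBasis ι ℂ H) (A : H →L[ℂ] H) : ℂ :=
  ∑' i, ⟪e i, A (e i)⟫_ℂ

/-- `T` is hyponormal (`‖T⋆x‖ ≤ ‖Tx‖`, i.e. `[T⋆,T] ≥ 0`) and *purely* so: there is no
nonzero closed subspace, invariant under `T` and `T⋆`, on which `T` is normal. -/
def PurelyHyponormal (T : H →L[ℂ] H) : Prop :=
  (∀ x : H, ‖ContinuousLinearMap.adjoint T x‖ ≤ ‖T x‖) ∧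
  ∀ S : Submodule ℂ H, IsClosed (S : Set H) →
    (∀ x ∈ S, T x ∈ S) → (∀ x ∈ S, ContinuousLinearMap.adjoint T x ∈ S) →
    (∀ x ∈ S, ‖T x‖ = ‖ContinuousLinearMap.adjoint T x‖) → S = ⊥

/-- Assumption (A): `T = X + iY` is purely hyponormal with `X, Y` selfadjoint,
`[T⋆,T] = −2i[Y,X] = 2D²` is a positive trace-class operator, and
`σ(X) ∪ σ(Y) ⊆ [a,b]`. -/
structure AssumptionA {ι : Type*} (e : HilbertBasis ι ℂ H)
    (X Y D2 : H →L[ℂ] H) (a b : ℝ) : Prop where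
  hab : a ≤ b
  hX : IsSelfAdjoint X
  hY : IsSelfAdjoint Y
  hpure : PurelyHyponormal (X + Complex.I • Y)
  hD2 : (2 : ℂ) • D2 = (-(2 : ℂ) * Complex.I) • (Y * X - X * Y)
  hpos : D2.IsPositive
  htc : IsTraceClass e D2
  hspecX : spectrum ℝ X ⊆ Set.Icc a b
  hspecY : spectrum ℝ Y ⊆ Set.Icc a b

/-- `ψ ∈ C¹₁`: `ψ(β) = (2π)^{-1/2} ∫ ψ̂(α) e^{iαβ} dα` for some `ψ̂` with
`∫ |ψ̂(α)|(1+|α|) dα < ∞`. -/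
def MemC11 (ψ : ℝ → ℂ) : Prop :=
  ∃ g : ℝ → ℂ, Integrable g ∧ Integrable (fun α : ℝ => α • g α) ∧
    ∀ β : ℝ, ψ β = (Real.sqrt (2 * Real.pi))⁻¹ •
      ∫ α : ℝ, Complex.exp (Complex.I * (α : ℂ) * (β : ℂ)) • g α

/-- `ψ` is (the function given by) a polynomial with complex coefficients. -/
def IsPolyFun (ψ : ℝ → ℂ) : Prop :=
  ∃ p : Polynomial ℂ, ∀ t : ℝ, ψ t = Polynomial.eval (t : ℂ) p

/-- `ψ` is either in `C¹₁([a,b])` or a polynomial. -/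
def GoodFun (ψ : ℝ → ℂ) : Prop := MemC11 ψ ∨ IsPolyFun ψ

/-- `E` is the spectral measure of the selfadjoint operator `A`: a projection-valued,
countably additive measure on `ℝ` such that `⟪x, f(A) x⟫ = ∫ f dμ_x`, where `μ_x` is the
finite positive measure `μ_x(Δ) = ⟪x, E(Δ) x⟫`. -/
def IsSpectralMeasureOf (A : H →L[ℂ] H) (E : Set ℝ → H →L[ℂ] H) : Prop :=
  (∀ Δ : Set ℝ, IsSelfAdjoint (E Δ)) ∧
  (∀ Δ Ω : Set ℝ, E (Δ ∩ Ω) = E Δ * E Ω) ∧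
  E Set.univ = 1 ∧
  (∀ Δ : ℕ → Set ℝ, (∀ n, MeasurableSet (Δ n)) → Pairwise (Function.onFun Disjoint Δ) →
    ∀ x : H, HasSum (fun n => E (Δ n) x) (E (⋃ n, Δ n) x)) ∧
  ∀ x : H, ∃ μ : Measure ℝ, IsFiniteMeasure μ ∧
    (∀ Δ : Set ℝ, MeasurableSet Δ → (μ Δ).toReal = (⟪x, E Δ x⟫_ℂ).re) ∧
    ∀ f : ℝ → ℝ, Continuous f → (⟪x, cfc f A x⟫_ℂ).re = ∫ t, f t ∂μ

/-- An indefinite integral `𝒥(χ_Δ)` of the characteristic function of `Δ`. -/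
noncomputable def Jind (a : ℝ) (Δ : Set ℝ) (t : ℝ) : ℝ :=
  ∫ s in a..t, Set.indicator Δ (fun _ => (1 : ℝ)) s

/-- `𝒥(χ_Δ)(A)`. -/
noncomputable def JindOp (a : ℝ) (Δ : Set ℝ) (A : H →L[ℂ] H) : H →L[ℂ] H :=
  fc (fun t => (Jind a Δ t : ℂ)) A

/-- `ψ ∈ C¹([a,b])` with derivative `ψd` on `[a,b]`. -/
def HasDerivOnIcc (ψ ψd : ℝ → ℂ) (a b : ℝ) : Prop :=
  (∀ t ∈ Set.Icc a b, HasDerivWithinAt ψ (ψd t) (Set.Icc a b) t) ∧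
  ContinuousOn ψd (Set.Icc a b)

/-- `r` is a Carey–Pincus principal function for the pair `X, Y`: a nonnegative
`L¹([a,b]²)` function with `Tr(−i[ψ(Y), φ(X)]) = ∫∫ φ′(t) ψ′(λ) r(t,λ) dt dλ`
for all `ψ, φ ∈ C¹([a,b])`. -/
def IsPrincipalFunction {ι : Type*} (e : HilbertBasis ι ℂ H) (X Y : H →L[ℂ] H)
    (a b : ℝ) (r : ℝ → ℝ → ℝ) : Prop :=
  IntegrableOn (fun q : ℝ × ℝ => r q.1 q.2) (Set.Icc a b ×ˢ Set.Icc a b) ∧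
  (∀ᵐ q : ℝ × ℝ ∂(volume : Measure (ℝ × ℝ)),
    q ∈ Set.Icc a b ×ˢ Set.Icc a b → 0 ≤ r q.1 q.2) ∧
  ∀ ψ ψd φ φd : ℝ → ℂ, HasDerivOnIcc ψ ψd a b → HasDerivOnIcc φ φd a b →
    trace e ((-Complex.I) • (fc ψ Y * fc φ X - fc φ X * fc ψ Y)) =
      ∫ t in Set.Icc a b, ∫ l in Set.Icc a b, φd t * ψd l * (r t l : ℂ)

/-- The Jacobian `J(F,G)(t,λ) = ∂F/∂t ∂G/∂λ − ∂F/∂λ ∂G/∂t`. -/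
noncomputable def Jac (F G : ℝ → ℝ → ℂ) (t l : ℝ) : ℂ :=
  deriv (fun s => F s l) t * deriv (fun s => G t s) l -
    deriv (fun s => F t s) l * deriv (fun s => G s l) t

set_option linter.unusedSectionVars false

/-! ### Hilbert–Schmidt operators -/

section HS

variable {ι : Type*} (e : HilbertBasis ι ℂ H)

/-- Hilbert–Schmidt operators. -/
def HS (P : H →L[ℂ] H) : Prop := Summable fun i => ‖P (e i)‖ ^ 2

lemma hasSum_norm_sq (x : H) : HasSum (fun i => ‖⟪e i, x⟫_ℂ‖ ^ 2) (‖x‖ ^ 2) := by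
  have h := e.hasSum_inner_mul_inner x x
  have h2 := Complex.hasSum_re h
  have h3 : (fun i => (⟪x, e i⟫_ℂ * ⟪e i, x⟫_ℂ).re) = fun i => ‖⟪e i, x⟫_ℂ‖ ^ 2 := by
    funext i
    rw [← inner_conj_symm x (e i), Complex.conj_mul']
    norm_cast
  rw [h3] at h2
  rw [inner_self_eq_norm_sq_to_K] at h2
  convert h2 using 1
  norm_cast

lemma HS.summable_prod {P : H →L[ℂ] H} (h : HS e P) :
    Summable fun q : ι × ι => ‖⟪e q.2, P (e q.1)⟫_ℂ‖ ^ 2 := by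
  rw [summable_prod_of_nonneg (fun q => by positivity)]
  refine ⟨fun i => (hasSum_norm_sq e (P (e i))).summable, ?_⟩
  have h3 : (fun i => ∑' j, ‖⟪e j, P (e i)⟫_ℂ‖ ^ 2) = fun i => ‖P (e i)‖ ^ 2 :=
    funext fun i => (hasSum_norm_sq e (P (e i))).tsum_eq
  exact h3 ▸ h

lemma norm_inner_adjoint (P : H →L[ℂ] H) (x y : H) :
    ‖⟪x, ContinuousLinearMap.adjoint P y⟫_ℂ‖ = ‖⟪y, P x⟫_ℂ‖ := by
  rw [ContinuousLinearMap.adjoint_inner_right, norm_inner_symm]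

lemma HS.adjoint {P : H →L[ℂ] H} (h : HS e P) :
    HS e (ContinuousLinearMap.adjoint P) := by
  have h1 := (HS.summable_prod e h)
  have h2 : Summable fun q : ι × ι =>
      ‖⟪e q.2, ContinuousLinearMap.adjoint P (e q.1)⟫_ℂ‖ ^ 2 := by
    convert h1.prod_symm using 2 with q
    rw [norm_inner_adjoint]
    rfl
  rw [summable_prod_of_nonneg (fun q => by positivity)] at h2
  have h3 : (fun i => ∑' j, ‖⟪e j, ContinuousLinearMap.adjoint P (e i)⟫_ℂ‖ ^ 2) =
      fun i => ‖ContinuousLinearMap.adjoint P (e i)‖ ^ 2 :=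
    funext fun i => (hasSum_norm_sq e _).tsum_eq
  unfold HS
  rw [← h3]
  exact h2.2

lemma HS.tsum_adjoint {P : H →L[ℂ] H} (h : HS e P) :
    ∑' i, ‖ContinuousLinearMap.adjoint P (e i)‖ ^ 2 = ∑' i, ‖P (e i)‖ ^ 2 := by
  have h1 := (HS.summable_prod e h)
  have h3 := h1.tsum_comm (f := fun i j => ‖⟪e j, P (e i)⟫_ℂ‖ ^ 2)
  calc _ = ∑' j, ∑' i, ‖⟪e j, P (e i)⟫_ℂ‖ ^ 2 := by
        congr 1
        funext j
        rw [← (hasSum_norm_sq e _).tsum_eq]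
        congr 1
        funext i
        rw [norm_inner_adjoint]
    _ = _ := by
        rw [h3]
        congr 1
        funext i
        rw [(hasSum_norm_sq e _).tsum_eq]

lemma HS.mul_left {P : H →L[ℂ] H} (h : HS e P) (S : H →L[ℂ] H) : HS e (S * P) := by
  refine Summable.of_nonneg_of_le (fun i => by positivity) (fun i => ?_)
    (Summable.mul_left (‖S‖ ^ 2) h)
  rw [← mul_pow]
  gcongr
  exact S.le_opNorm _

lemma HS.mul_right {P : H →L[ℂ] H} (h : HS e P) (S : H →L[ℂ] H) : HS e (P * S) := by
  have h1 := HS.adjoint e (HS.mul_left e (HS.adjoint e h) (ContinuousLinearMap.adjoint S))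
  have h2 : ContinuousLinearMap.adjoint
      (ContinuousLinearMap.adjoint S * ContinuousLinearMap.adjoint P) = P * S := by
    change star (star S * star P) = _
    simp
  rwa [h2] at h1

lemma HS.norm_inner_mul_le (P Q : H →L[ℂ] H) (i : ι) :
    ‖⟪e i, (P * Q) (e i)⟫_ℂ‖ ≤
      ‖ContinuousLinearMap.adjoint P (e i)‖ ^ 2 + ‖Q (e i)‖ ^ 2 := by
  have h1 : ⟪e i, (P * Q) (e i)⟫_ℂ = ⟪ContinuousLinearMap.adjoint P (e i), Q (e i)⟫_ℂ := by
    rw [ContinuousLinearMap.adjoint_inner_left]; rfl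
  rw [h1]
  have h2 := norm_inner_le_norm (𝕜 := ℂ) (ContinuousLinearMap.adjoint P (e i)) (Q (e i))
  nlinarith [sq_nonneg (‖ContinuousLinearMap.adjoint P (e i)‖ - ‖Q (e i)‖),
    sq_nonneg (‖ContinuousLinearMap.adjoint P (e i)‖ + ‖Q (e i)‖)]

lemma HS.summable_inner {P Q : H →L[ℂ] H} (hP : HS e P) (hQ : HS e Q) :
    Summable fun i => ⟪e i, (P * Q) (e i)⟫_ℂ := by
  apply Summable.of_norm_bounded (Summable.add (HS.adjoint e hP) hQ)
  exact fun i => HS.norm_inner_mul_le e P Q i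

lemma HS.trace_comm {P Q : H →L[ℂ] H} (hP : HS e P) (hQ : HS e Q) :
    trace e (P * Q) = trace e (Q * P) := by
  have key : ∀ P Q : H →L[ℂ] H, trace e (P * Q) =
      ∑' i, ∑' j, ⟪e i, P (e j)⟫_ℂ * ⟪e j, Q (e i)⟫_ℂ := by
    intro P Q
    unfold trace
    congr 1
    funext i
    have h1 : ⟪e i, (P * Q) (e i)⟫_ℂ = ⟪ContinuousLinearMap.adjoint P (e i), Q (e i)⟫_ℂ := by
      rw [ContinuousLinearMap.adjoint_inner_left]; rfl
    rw [h1, ← e.tsum_inner_mul_inner]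
    congr 1
    funext j
    rw [ContinuousLinearMap.adjoint_inner_left]
  have hs : Summable (Function.uncurry fun i j => ⟪e i, P (e j)⟫_ℂ * ⟪e j, Q (e i)⟫_ℂ) := by
    apply Summable.of_norm_bounded
      (Summable.add (HS.summable_prod e hP).prod_symm (HS.summable_prod e hQ))
    rintro ⟨i, j⟩
    simp only [Function.uncurry, norm_mul, Prod.swap]
    nlinarith [sq_nonneg (‖⟪e i, P (e j)⟫_ℂ‖ - ‖⟪e j, Q (e i)⟫_ℂ‖),
      sq_nonneg (‖⟪e i, P (e j)⟫_ℂ‖ + ‖⟪e j, Q (e i)⟫_ℂ‖)]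
  rw [key P Q, key Q P, ← hs.tsum_comm]
  simp only [mul_comm]

/-! ### The trace ideal -/

/-- The span of products of two Hilbert–Schmidt operators. -/
def TC : Submodule ℂ (H →L[ℂ] H) :=
  Submodule.span ℂ {A | ∃ P Q, HS e P ∧ HS e Q ∧ A = P * Q}

variable {e}

lemma TC.mul_left {A : H →L[ℂ] H} (h : A ∈ TC e) (S : H →L[ℂ] H) : S * A ∈ TC e := by
  refine Submodule.span_induction (p := fun A _ => S * A ∈ TC e) ?_ ?_ ?_ ?_ h
  · rintro _ ⟨P, Q, hP, hQ, rfl⟩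
    exact Submodule.subset_span ⟨S * P, Q, HS.mul_left e hP S, hQ, (mul_assoc _ _ _).symm⟩
  · simp
  · intro A B _ _ hA hB
    rw [mul_add]; exact add_mem hA hB
  · intro c A _ hA
    rw [mul_smul_comm]; exact Submodule.smul_mem _ _ hA

lemma TC.mul_right {A : H →L[ℂ] H} (h : A ∈ TC e) (S : H →L[ℂ] H) : A * S ∈ TC e := by
  refine Submodule.span_induction (p := fun A _ => A * S ∈ TC e) ?_ ?_ ?_ ?_ h
  · rintro _ ⟨P, Q, hP, hQ, rfl⟩
    exact Submodule.subset_span ⟨P, Q * S, hP, HS.mul_right e hQ S, (mul_assoc _ _ _)⟩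
  · simp
  · intro A B _ _ hA hB
    rw [add_mul]; exact add_mem hA hB
  · intro c A _ hA
    rw [smul_mul_assoc]; exact Submodule.smul_mem _ _ hA

lemma TC.summable {A : H →L[ℂ] H} (h : A ∈ TC e) :
    Summable fun i => ⟪e i, A (e i)⟫_ℂ := by
  refine Submodule.span_induction
    (p := fun A _ => Summable fun i => ⟪e i, A (e i)⟫_ℂ) ?_ ?_ ?_ ?_ h
  · rintro _ ⟨P, Q, hP, hQ, rfl⟩
    exact HS.summable_inner e hP hQ
  · simpa using summable_zero
  · intro A B _ _ hA hB
    simpa [inner_add_right] using hA.add hB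
  · intro c A _ hA
    simpa [inner_smul_right] using hA.mul_left c

lemma trace_zero : trace e (0 : H →L[ℂ] H) = 0 := by simp [trace]

lemma trace_smul (c : ℂ) (A : H →L[ℂ] H) : trace e (c • A) = c * trace e A := by
  simp [trace, inner_smul_right, tsum_mul_left]

lemma TC.trace_add {A B : H →L[ℂ] H} (hA : A ∈ TC e) (hB : B ∈ TC e) :
    trace e (A + B) = trace e A + trace e B := by
  unfold trace
  rw [← (TC.summable hA).tsum_add (TC.summable hB)]
  simp [inner_add_right]

lemma TC.trace_sub {A B : H →L[ℂ] H} (hA : A ∈ TC e) (hB : B ∈ TC e) :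
    trace e (A - B) = trace e A - trace e B := by
  unfold trace
  rw [← (TC.summable hA).tsum_sub (TC.summable hB)]
  simp [inner_sub_right]

lemma TC.trace_comm {A : H →L[ℂ] H} (h : A ∈ TC e) (S : H →L[ℂ] H) :
    trace e (S * A) = trace e (A * S) := by
  refine Submodule.span_induction
    (p := fun A _ => trace e (S * A) = trace e (A * S)) ?_ ?_ ?_ ?_ h
  · rintro _ ⟨P, Q, hP, hQ, rfl⟩
    rw [← mul_assoc, HS.trace_comm e (HS.mul_left e hP S) hQ, ← mul_assoc,
      HS.trace_comm e (HS.mul_right e hQ S) hP, mul_assoc]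
  · simp
  · intro A B hA' hB' hA hB
    rw [mul_add, add_mul, TC.trace_add (TC.mul_left hA' S) (TC.mul_left hB' S),
      TC.trace_add (TC.mul_right hA' S) (TC.mul_right hB' S), hA, hB]
  · intro c A _ hA
    rw [mul_smul_comm, smul_mul_assoc, trace_smul, trace_smul, hA]

lemma TC.bound {A : H →L[ℂ] H} (h : A ∈ TC e) :
    ∃ C : ℝ, ∀ U : H →L[ℂ] H, ‖U‖ ≤ 1 → ∀ F : Finset ι,
      ∑ i ∈ F, ‖⟪e i, (U * A) (e i)⟫_ℂ‖ ≤ C := by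
  refine Submodule.span_induction
    (p := fun A _ => ∃ C : ℝ, ∀ U : H →L[ℂ] H, ‖U‖ ≤ 1 → ∀ F : Finset ι,
      ∑ i ∈ F, ‖⟪e i, (U * A) (e i)⟫_ℂ‖ ≤ C) ?_ ?_ ?_ ?_ h
  · rintro _ ⟨P, Q, hP, hQ, rfl⟩
    refine ⟨(∑' i, ‖P (e i)‖ ^ 2) + ∑' i, ‖Q (e i)‖ ^ 2, fun U hU F => ?_⟩
    have hUP := HS.mul_left e hP U
    calc _ ≤ ∑ i ∈ F, (‖ContinuousLinearMap.adjoint (U * P) (e i)‖ ^ 2 + ‖Q (e i)‖ ^ 2) := by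
          refine Finset.sum_le_sum fun i _ => ?_
          rw [← mul_assoc]
          exact HS.norm_inner_mul_le e _ _ i
      _ = _ := Finset.sum_add_distrib
      _ ≤ (∑' i, ‖ContinuousLinearMap.adjoint (U * P) (e i)‖ ^ 2) + ∑' i, ‖Q (e i)‖ ^ 2 :=
          add_le_add ((HS.adjoint e hUP).sum_le_tsum F fun i _ => by positivity)
            (Summable.sum_le_tsum F (fun i _ => by positivity) hQ)
      _ ≤ _ := by
          rw [HS.tsum_adjoint e hUP]
          refine add_le_add ?_ le_rfl
          refine Summable.tsum_le_tsum (fun i => ?_) hUP hP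
          gcongr
          calc ‖U (P (e i))‖ ≤ ‖U‖ * ‖P (e i)‖ := U.le_opNorm _
            _ ≤ 1 * ‖P (e i)‖ := by gcongr
            _ = _ := one_mul _
  · exact ⟨0, by simp⟩
  · rintro A B _ _ ⟨C, hC⟩ ⟨C', hC'⟩
    refine ⟨C + C', fun U hU F => le_trans ?_ (add_le_add (hC U hU F) (hC' U hU F))⟩
    rw [← Finset.sum_add_distrib]
    refine Finset.sum_le_sum fun i _ => ?_
    rw [mul_add, ContinuousLinearMap.add_apply, inner_add_right]
    exact norm_add_le _ _
  · rintro c A _ ⟨C, hC⟩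
    refine ⟨‖c‖ * C, fun U hU F => ?_⟩
    refine le_trans (le_of_eq ?_) (mul_le_mul_of_nonneg_left (hC U hU F) (norm_nonneg c))
    rw [Finset.mul_sum]
    refine Finset.sum_congr rfl fun i _ => ?_
    rw [mul_smul_comm, ContinuousLinearMap.smul_apply, inner_smul_right, norm_mul]

lemma absOp_approx (A : H →L[ℂ] H) {ε : ℝ} (hε : 0 < ε) :
    ∃ U : H →L[ℂ] H, ‖U‖ ≤ 1 ∧ ∀ x : H,
      (⟪x, absOp A x⟫_ℂ).re ≤ (⟪x, (U * A) x⟫_ℂ).re + ε * ‖x‖ ^ 2 := by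
  set B : H →L[ℂ] H := star A * A with hB
  have hB0 : 0 ≤ B := star_mul_self_nonneg A
  have hBsa : IsSelfAdjoint B := .of_nonneg hB0
  have hsp : ∀ x ∈ spectrum ℝ B, 0 ≤ x := fun x hx => spectrum_nonneg_of_nonneg hB0 hx
  set g : ℝ → ℝ := fun t => (Real.sqrt t + ε)⁻¹ with hg
  have hpos : ∀ t, 0 < Real.sqrt t + ε := fun t => by positivity
  have hgc : Continuous g := by
    apply Continuous.inv₀ (by fun_prop)
    exact fun t => (hpos t).ne'
  set G := cfc g B with hG
  have hGsa : star G = G := (cfc_predicate g B : IsSelfAdjoint _)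
  have hGB : G * B = cfc (fun t => g t * t) B := by
    rw [cfc_mul g (fun t => t) B hgc.continuousOn continuousOn_id, cfc_id' ℝ B]
  refine ⟨G * star A, ?_, fun x => ?_⟩
  · have h1 : (G * star A) * star (G * star A) = cfc (fun t => g t * t * g t) B := by
      rw [cfc_mul (fun t => g t * t) g B (by fun_prop) hgc.continuousOn, ← hGB]
      rw [star_mul, star_star, hGsa]
      simp only [mul_assoc, hB, hG]
    have h2 : ‖(G * star A) * star (G * star A)‖ ≤ 1 := by
      rw [h1]
      refine norm_cfc_le zero_le_one fun t ht => ?_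
      have ht0 := hsp t ht
      have hp := hpos t
      have hs := Real.sqrt_nonneg t
      rw [Real.norm_of_nonneg (by positivity)]
      simp only [hg]
      rw [← Real.sq_sqrt ht0]
      simp only [Real.sqrt_sq hs]
      field_simp
      gcongr
      linarith
    rw [CStarRing.norm_self_mul_star] at h2
    nlinarith [norm_nonneg (G * star A)]
  · have h1 : absOp A ≤ G * star A * A + ε • (1 : H →L[ℂ] H) := by
      have h2 : G * star A * A + ε • (1 : H →L[ℂ] H) = cfc (fun t => g t * t + ε) B := by
        rw [cfc_add_const ε (fun t => g t * t) B (by fun_prop), ← hGB, mul_assoc,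
          Algebra.algebraMap_eq_smul_one]
      rw [h2]
      refine cfc_mono (fun t ht => ?_) (by fun_prop) (by fun_prop)
      have ht0 := hsp t ht
      have hp := hpos t
      have hs := Real.sqrt_nonneg t
      simp only [hg]
      conv_rhs => rw [← Real.sq_sqrt ht0]
      simp only [Real.sqrt_sq hs]
      field_simp
      nlinarith
    have h3 := (ContinuousLinearMap.le_def _ _).1 h1
    have h4 := h3.re_inner_nonneg_right x
    simp only [ContinuousLinearMap.sub_apply, ContinuousLinearMap.add_apply, inner_sub_right,
      inner_add_right, ContinuousLinearMap.smul_apply, ContinuousLinearMap.one_apply,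
      map_sub, map_add] at h4
    have h5 : RCLike.re ⟪x, ε • x⟫_ℂ = ε * ‖x‖ ^ 2 := by
      rw [inner_smul_right_eq_smul, RCLike.smul_re, inner_self_eq_norm_sq]
    rw [h5] at h4
    have h6 : ∀ z : ℂ, RCLike.re z = z.re := fun z => rfl
    simp only [h6] at h4
    linarith

lemma absOp_nonneg (A : H →L[ℂ] H) (x : H) : 0 ≤ (⟪x, absOp A x⟫_ℂ).re := by
  have h : (0 : H →L[ℂ] H) ≤ absOp A := cfc_nonneg fun t _ => Real.sqrt_nonneg t
  exact ((ContinuousLinearMap.nonneg_iff_isPositive _).1 h).re_inner_nonneg_right x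

lemma TC.isTraceClass {A : H →L[ℂ] H} (h : A ∈ TC e) : IsTraceClass e A := by
  obtain ⟨C, hC⟩ := TC.bound h
  refine summable_of_sum_le (c := C) (fun i => absOp_nonneg A _) fun F => ?_
  refine le_of_forall_pos_le_add fun δ hδ => ?_
  have hε : 0 < δ / (F.card + 1) := by positivity
  obtain ⟨U, hU, hx⟩ := absOp_approx A hε
  calc _ ≤ ∑ i ∈ F, (‖⟪e i, (U * A) (e i)⟫_ℂ‖ + δ / (F.card + 1)) := by
        refine Finset.sum_le_sum fun i _ => (hx (e i)).trans ?_
        rw [e.orthonormal.1 i]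
        simp only [one_pow, mul_one]
        gcongr
        exact Complex.re_le_norm _
    _ = (∑ i ∈ F, ‖⟪e i, (U * A) (e i)⟫_ℂ‖) + F.card * (δ / (F.card + 1)) := by
        rw [Finset.sum_add_distrib, Finset.sum_const, nsmul_eq_mul]
    _ ≤ C + δ := by
        gcongr
        · exact hC U hU F
        · rw [mul_div_assoc', div_le_iff₀ (by positivity)]
          nlinarith

lemma absOp_of_nonneg {A : H →L[ℂ] H} (h : 0 ≤ A) : absOp A = A := by
  have hsa : star A = A := (IsSelfAdjoint.of_nonneg h)
  have h1 : ContinuousLinearMap.adjoint A * A = A * A := by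
    change star A * A = _
    rw [hsa]
  have h0 : 0 ≤ A * A := by
    rw [← h1]
    exact star_mul_self_nonneg A
  unfold absOp
  rw [h1, ← cfcₙ_eq_cfc, ← CFC.sqrt_eq_real_sqrt _ h0, CFC.sqrt_mul_self A h]

lemma TC.of_nonneg {A : H →L[ℂ] H} (h : 0 ≤ A) (ht : IsTraceClass e A) : A ∈ TC e := by
  unfold IsTraceClass at ht
  rw [absOp_of_nonneg h] at ht
  set S := CFC.sqrt A with hS
  have hSS : S * S = A := CFC.sqrt_mul_sqrt_self A h
  have hsa : ContinuousLinearMap.adjoint S = S :=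
    (IsSelfAdjoint.of_nonneg (CFC.sqrt_nonneg A))
  have hHS : HS e S := by
    unfold HS
    convert ht using 2 with i
    rw [← hSS]
    change _ = (⟪e i, S (S (e i))⟫_ℂ).re
    rw [← ContinuousLinearMap.adjoint_inner_left, hsa, inner_self_eq_norm_sq_to_K]
    norm_cast
  exact Submodule.subset_span ⟨S, S, hHS, hHS, hSS.symm⟩

end HS

/-! ### Commutators -/

section Comm

variable {ι : Type*} {e : HilbertBasis ι ℂ H}

lemma TC.comm_aeval {Q Z : H →L[ℂ] H} (h : Q * Z - Z * Q ∈ TC e) (f : Polynomial ℂ) :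
    Q * aeval Z f - aeval Z f * Q ∈ TC e := by
  induction f using Polynomial.induction_on' with
  | add p q hp hq =>
    have : Q * aeval Z (p + q) - aeval Z (p + q) * Q =
        (Q * aeval Z p - aeval Z p * Q) + (Q * aeval Z q - aeval Z q * Q) := by
      rw [map_add]; noncomm_ring
    rw [this]; exact add_mem hp hq
  | monomial n c =>
    have h1 : Q * Z ^ n - Z ^ n * Q ∈ TC e := by
      induction n with
      | zero => simp
      | succ n ih =>
        have : Q * Z ^ (n + 1) - Z ^ (n + 1) * Q =
            (Q * Z ^ n - Z ^ n * Q) * Z + Z ^ n * (Q * Z - Z * Q) := by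
          rw [pow_succ]; noncomm_ring
        rw [this]
        exact add_mem (TC.mul_right ih _) (TC.mul_left h _)
    have h2 : Q * aeval Z (monomial n c) - aeval Z (monomial n c) * Q =
        c • (Q * Z ^ n - Z ^ n * Q) := by
      rw [aeval_monomial, Algebra.algebraMap_eq_smul_one, smul_one_mul, mul_smul_comm,
        smul_mul_assoc, smul_sub]
    rw [h2]
    exact Submodule.smul_mem _ _ h1

lemma comm_symm {P Q : H →L[ℂ] H} (h : Q * P - P * Q ∈ TC e) : P * Q - Q * P ∈ TC e := by
  rw [← neg_sub]; exact neg_mem h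

lemma TC.comm_aeval₂ {Y Z : H →L[ℂ] H} (h : Y * Z - Z * Y ∈ TC e) (f g : Polynomial ℂ) :
    aeval Y g * aeval Z f - aeval Z f * aeval Y g ∈ TC e :=
  TC.comm_aeval (comm_symm (TC.comm_aeval (comm_symm h) g)) f

/-- `Tr(α(Z)[Q, f(Z)]) = Tr((αf')(Z)[Q, Z])`. -/
lemma TC.trace_comm_aeval {Q Z : H →L[ℂ] H} (h : Q * Z - Z * Q ∈ TC e) (f : Polynomial ℂ) :
    ∀ α : Polynomial ℂ, trace e (aeval Z α * (Q * aeval Z f - aeval Z f * Q)) =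
      trace e (aeval Z (α * derivative f) * (Q * Z - Z * Q)) := by
  induction f using Polynomial.induction_on' with
  | add p q hp hq =>
    intro α
    have h1 : aeval Z α * (Q * aeval Z (p + q) - aeval Z (p + q) * Q) =
        aeval Z α * (Q * aeval Z p - aeval Z p * Q) +
          aeval Z α * (Q * aeval Z q - aeval Z q * Q) := by
      rw [map_add]; noncomm_ring
    rw [h1, TC.trace_add (TC.mul_left (TC.comm_aeval h p) _) (TC.mul_left (TC.comm_aeval h q) _),
      hp, hq, ← TC.trace_add (TC.mul_left h _) (TC.mul_left h _), ← add_mul, ← map_add,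
      derivative_add, mul_add]
  | monomial n c =>
    have key : ∀ α : Polynomial ℂ, trace e (aeval Z α * (Q * Z ^ n - Z ^ n * Q)) =
        trace e (aeval Z (α * derivative (X ^ n)) * (Q * Z - Z * Q)) := by
      induction n with
      | zero => intro α; simp
      | succ n ih =>
        intro α
        have hn : Q * Z ^ n - Z ^ n * Q ∈ TC e := by
          simpa using TC.comm_aeval h (X ^ n)
        have h1 : aeval Z α * (Q * Z ^ (n + 1) - Z ^ (n + 1) * Q) =
            (aeval Z α * (Q * Z ^ n - Z ^ n * Q)) * Z +
              aeval Z (α * X ^ n) * (Q * Z - Z * Q) := by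
          rw [pow_succ, map_mul, map_pow, aeval_X]; noncomm_ring
        rw [h1, TC.trace_add (TC.mul_right (TC.mul_left hn _) _) (TC.mul_left h _),
          ← TC.trace_comm (TC.mul_left hn _), ← mul_assoc]
        have h2 : Z * aeval Z α = aeval Z (X * α) := by rw [map_mul, aeval_X]
        rw [h2, ih, ← TC.trace_add (TC.mul_left h _) (TC.mul_left h _), ← add_mul, ← map_add]
        congr 3
        rw [pow_succ, derivative_mul, derivative_X]
        ring_nf
    intro α
    have h2 : aeval Z α * (Q * aeval Z (monomial n c) - aeval Z (monomial n c) * Q) =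
        c • (aeval Z α * (Q * Z ^ n - Z ^ n * Q)) := by
      rw [aeval_monomial, Algebra.algebraMap_eq_smul_one, smul_one_mul, mul_smul_comm,
        smul_mul_assoc, ← smul_sub, mul_smul_comm]
    have h3 : aeval Z (α * derivative (monomial n c)) =
        c • aeval Z (α * derivative (X ^ n)) := by
      rw [← C_mul_X_pow_eq_monomial, derivative_C_mul, ← smul_eq_C_mul, mul_smul_comm, map_smul]
    rw [h2, h3, trace_smul, key, smul_mul_assoc, trace_smul]

lemma exists_antideriv (p : Polynomial ℂ) : ∃ G : Polynomial ℂ, derivative G = p := by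
  induction p using Polynomial.induction_on' with
  | add p q hp hq =>
    obtain ⟨P, rfl⟩ := hp
    obtain ⟨Q, rfl⟩ := hq
    exact ⟨P + Q, derivative_add⟩
  | monomial n c =>
    refine ⟨monomial (n + 1) (c / (n + 1)), ?_⟩
    rw [derivative_monomial]
    have : ((n : ℂ) + 1) ≠ 0 := by exact_mod_cast n.succ_ne_zero
    congr 1
    push_cast
    field_simp

lemma TC.trace_comm_antideriv {Q Z : H →L[ℂ] H} (h : Q * Z - Z * Q ∈ TC e)
    {f α G : Polynomial ℂ} (hG : derivative G = α * derivative f) :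
    trace e (aeval Z α * (Q * aeval Z f - aeval Z f * Q)) =
      trace e (Q * aeval Z G - aeval Z G * Q) := by
  have h1 := TC.trace_comm_aeval h G 1
  rw [TC.trace_comm_aeval h, ← hG]
  simpa using h1.symm

lemma fc_poly {A : H →L[ℂ] H} (hA : IsSelfAdjoint A) (p : Polynomial ℂ) :
    fc (fun t : ℝ => Polynomial.eval (t : ℂ) p) A = aeval A p := by
  have hn : IsStarNormal A := hA.isStarNormal
  unfold fc
  rw [← cfc_polynomial p A hn]
  refine cfc_congr fun z hz => ?_
  simp only
  rw [← hA.mem_spectrum_eq_re hz]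

lemma hasDerivAt_poly (p : Polynomial ℂ) (t : ℝ) :
    HasDerivAt (fun t : ℝ => Polynomial.eval (t : ℂ) p)
      (Polynomial.eval (t : ℂ) (derivative p)) t :=
  (p.hasDerivAt (t : ℂ)).comp_ofReal

lemma continuous_poly (p : Polynomial ℂ) :
    Continuous (fun t : ℝ => Polynomial.eval (t : ℂ) p) :=
  p.continuous.comp Complex.continuous_ofReal

lemma hasDerivOnIcc_poly (p : Polynomial ℂ) (a b : ℝ) :
    HasDerivOnIcc (fun t : ℝ => Polynomial.eval (t : ℂ) p)
      (fun t : ℝ => Polynomial.eval (t : ℂ) (derivative p)) a b :=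
  ⟨fun t _ => (hasDerivAt_poly p t).hasDerivWithinAt, (continuous_poly _).continuousOn⟩

lemma integrableOn_poly {X Y : H →L[ℂ] H}
    {a b : ℝ} {r : ℝ → ℝ → ℝ} (hr : IsPrincipalFunction e X Y a b r)
    (F : ℝ × ℝ → ℂ) (hF : Continuous F) :
    IntegrableOn (fun z : ℝ × ℝ => F z * (r z.1 z.2 : ℂ)) (Set.Icc a b ×ˢ Set.Icc a b) :=
  IntegrableOn.continuousOn_mul hF.continuousOn hr.1.ofReal (isCompact_Icc.prod isCompact_Icc)

lemma principal_poly {X Y : H →L[ℂ] H} (hX : IsSelfAdjoint X) (hY : IsSelfAdjoint Y)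
    {a b : ℝ} {r : ℝ → ℝ → ℝ} (hr : IsPrincipalFunction e X Y a b r) (p q : Polynomial ℂ) :
    (-Complex.I) * trace e (aeval Y q * aeval X p - aeval X p * aeval Y q) =
      ∫ z in Set.Icc a b ×ˢ Set.Icc a b, Polynomial.eval (z.1 : ℂ) (derivative p) *
        Polynomial.eval (z.2 : ℂ) (derivative q) * (r z.1 z.2 : ℂ) := by
  have h := hr.2.2 _ _ _ _ (hasDerivOnIcc_poly q a b) (hasDerivOnIcc_poly p a b)
  rw [fc_poly hX, fc_poly hY, trace_smul] at h
  rw [h, Measure.volume_eq_prod, setIntegral_prod]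
  rw [← Measure.volume_eq_prod]
  exact integrableOn_poly hr (fun z => Polynomial.eval (z.1 : ℂ) (derivative p) *
        Polynomial.eval (z.2 : ℂ) (derivative q))
    (((continuous_poly _).comp continuous_fst).mul ((continuous_poly _).comp continuous_snd))

end Comm

theorem statement18 {ι : Type*} (e : HilbertBasis ι ℂ H) (X Y D2 : H →L[ℂ] H)
    (a b : ℝ) (hA : AssumptionA e X Y D2 a b)
    (r : ℝ → ℝ → ℝ) (hr : IsPrincipalFunction e X Y a b r)
    (α ψ φ β : Polynomial ℂ) :
    IsTraceClass e
      ((aeval X α * aeval Y ψ) * (aeval X φ * aeval Y β) -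
        (aeval X φ * aeval Y β) * (aeval X α * aeval Y ψ) -
       ((aeval X α * aeval Y (ψ * β)) * aeval X φ -
          aeval X φ * (aeval X α * aeval Y (ψ * β)) +
        ((aeval X (α * φ) * aeval Y ψ) * aeval Y β -
          aeval Y β * (aeval X (α * φ) * aeval Y ψ)))) ∧
    trace e
      ((aeval X α * aeval Y ψ) * (aeval X φ * aeval Y β) -
        (aeval X φ * aeval Y β) * (aeval X α * aeval Y ψ) -
       ((aeval X α * aeval Y (ψ * β)) * aeval X φ -
          aeval X φ * (aeval X α * aeval Y (ψ * β)) +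
        ((aeval X (α * φ) * aeval Y ψ) * aeval Y β -
          aeval Y β * (aeval X (α * φ) * aeval Y ψ)))) = 0 ∧
    (-Complex.I) * trace e
        ((aeval X α * aeval Y ψ) * (aeval X φ * aeval Y β) -
          (aeval X φ * aeval Y β) * (aeval X α * aeval Y ψ)) =
      (-Complex.I) * trace e
        ((aeval X α * aeval Y (ψ * β)) * aeval X φ -
          aeval X φ * (aeval X α * aeval Y (ψ * β))) +
      (-Complex.I) * trace e
        ((aeval X (α * φ) * aeval Y ψ) * aeval Y β -
          aeval Y β * (aeval X (α * φ) * aeval Y ψ)) ∧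
    (-Complex.I) * trace e
        ((aeval X α * aeval Y ψ) * (aeval X φ * aeval Y β) -
          (aeval X φ * aeval Y β) * (aeval X α * aeval Y ψ)) =
      ∫ t in Set.Icc a b, ∫ l in Set.Icc a b,
        -(Jac (fun s u => Polynomial.eval (s : ℂ) α * Polynomial.eval (u : ℂ) ψ)
            (fun s u => Polynomial.eval (s : ℂ) φ * Polynomial.eval (u : ℂ) β) t l) *
          (r t l : ℂ) := by
  have hYX : Y * X - X * Y ∈ TC e := by
    have h1 : D2 ∈ TC e :=
      TC.of_nonneg ((ContinuousLinearMap.nonneg_iff_isPositive _).2 hA.hpos) hA.htc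
    have h2 : Y * X - X * Y = Complex.I • D2 := by
      have h3 : (2 : ℂ) • (Complex.I • D2) = (2 : ℂ) • (Y * X - X * Y) := by
        rw [smul_comm, hA.hD2, smul_smul]
        congr 1
        linear_combination (-2 : ℂ) * Complex.I_mul_I
      exact (smul_right_injective _ (two_ne_zero : (2 : ℂ) ≠ 0) h3).symm
    rw [h2]
    exact Submodule.smul_mem _ _ h1
  set A := aeval X α with hAdef
  set P := aeval Y ψ with hP
  set F := aeval X φ with hF
  set B := aeval Y β with hB
  have hPB : aeval Y (ψ * β) = P * B := map_mul _ _ _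
  have hAF : aeval X (α * φ) = A * F := map_mul _ _ _
  have hFA : F * A = A * F := by rw [hAdef, hF, ← map_mul, ← map_mul, mul_comm]
  have hBP : B * P = P * B := by rw [hP, hB, ← map_mul, ← map_mul, mul_comm]
  -- the three commutators
  have hFB : F * B - B * F ∈ TC e := comm_symm (TC.comm_aeval₂ hYX φ β)
  have h1eq : (A * (P * B)) * F - F * (A * (P * B)) = A * (P * B * F - F * (P * B)) := by
    rw [← mul_assoc F A, hFA]; noncomm_ring
  have h1c : P * B * F - F * (P * B) ∈ TC e := by
    rw [← hPB]; exact TC.comm_aeval₂ hYX φ (ψ * β)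
  have h2eq : (A * F * P) * B - B * (A * F * P) = (A * F * B - B * (A * F)) * P := by
    rw [mul_assoc (A * F), ← hBP]; noncomm_ring
  have h2c : A * F * B - B * (A * F) ∈ TC e := by
    rw [← hAF]; exact comm_symm (TC.comm_aeval₂ hYX (α * φ) β)
  have hdiff : (A * P) * (F * B) - (F * B) * (A * P) -
       ((A * (P * B)) * F - F * (A * (P * B)) + ((A * F * P) * B - B * (A * F * P))) =
      (A * P) * (F * B - B * F) - (F * B - B * F) * (A * P) := by
    have e1 : F * (A * (P * B)) = A * F * P * B := by
      rw [← mul_assoc F A, hFA]; noncomm_ring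
    have e2 : B * (A * F * P) = B * F * (A * P) := by
      rw [← hFA]; noncomm_ring
    rw [e1, e2]; noncomm_ring
  have hdTC : (A * P) * (F * B - B * F) - (F * B - B * F) * (A * P) ∈ TC e :=
    sub_mem (TC.mul_left hFB _) (TC.mul_right hFB _)
  have hdtr : trace e ((A * P) * (F * B - B * F) - (F * B - B * F) * (A * P)) = 0 := by
    rw [TC.trace_sub (TC.mul_left hFB _) (TC.mul_right hFB _), TC.trace_comm hFB, sub_self]
  have hC1 : (A * (P * B)) * F - F * (A * (P * B)) ∈ TC e := by
    rw [h1eq]; exact TC.mul_left h1c _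
  have hC2 : (A * F * P) * B - B * (A * F * P) ∈ TC e := by
    rw [h2eq]; exact TC.mul_right h2c _
  have hthird : trace e ((A * P) * (F * B) - (F * B) * (A * P)) =
      trace e ((A * (P * B)) * F - F * (A * (P * B))) +
        trace e ((A * F * P) * B - B * (A * F * P)) := by
    have h := sub_eq_iff_eq_add.1 hdiff
    rw [h, TC.trace_add hdTC (add_mem hC1 hC2), hdtr, zero_add, TC.trace_add hC1 hC2]
  rw [hPB, hAF]
  refine ⟨?_, ?_, ?_, ?_⟩
  · rw [hdiff]; exact TC.isTraceClass hdTC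
  · rw [hdiff]; exact hdtr
  · rw [hthird, mul_add]
  · obtain ⟨G, hG⟩ := exists_antideriv (α * derivative φ)
    obtain ⟨S, hS⟩ := exists_antideriv (ψ * derivative β)
    have t1 : trace e ((A * (P * B)) * F - F * (A * (P * B))) =
        trace e (aeval Y (ψ * β) * aeval X G - aeval X G * aeval Y (ψ * β)) := by
      rw [h1eq, ← hPB]
      refine TC.trace_comm_antideriv ?_ hG
      exact comm_symm (TC.comm_aeval (comm_symm hYX) (ψ * β))
    have t2 : trace e ((A * F * P) * B - B * (A * F * P)) =
        -trace e (aeval Y S * aeval X (α * φ) - aeval X (α * φ) * aeval Y S) := by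
      rw [h2eq, ← TC.trace_comm h2c, ← hAF, TC.trace_comm_antideriv ?_ hS,
        ← neg_sub (aeval Y S * aeval X (α * φ))]
      · simpa using trace_smul (e := e) (-1)
          (aeval Y S * aeval X (α * φ) - aeval X (α * φ) * aeval Y S)
      · exact comm_symm (TC.comm_aeval hYX (α * φ))
    have p1 := principal_poly hA.hX hA.hY hr G (ψ * β)
    have p2 := principal_poly hA.hX hA.hY hr (α * φ) S
    rw [hthird, t1, t2, mul_add, mul_neg, p1, p2, ← sub_eq_add_neg]
    have hcont : ∀ p q : Polynomial ℂ, Continuous fun z : ℝ × ℝ =>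
        Polynomial.eval (z.1 : ℂ) p * Polynomial.eval (z.2 : ℂ) q := fun p q =>
      ((continuous_poly _).comp continuous_fst).mul ((continuous_poly _).comp continuous_snd)
    rw [← integral_sub (integrableOn_poly hr _ (hcont _ _)) (integrableOn_poly hr _ (hcont _ _))]
    have hJ : ∀ z : ℝ × ℝ,
        -(Jac (fun s u => Polynomial.eval (s : ℂ) α * Polynomial.eval (u : ℂ) ψ)
            (fun s u => Polynomial.eval (s : ℂ) φ * Polynomial.eval (u : ℂ) β) z.1 z.2) *
          (r z.1 z.2 : ℂ) =
        Polynomial.eval (z.1 : ℂ) (derivative G) *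
            Polynomial.eval (z.2 : ℂ) (derivative (ψ * β)) * (r z.1 z.2 : ℂ) -
          Polynomial.eval (z.1 : ℂ) (derivative (α * φ)) *
            Polynomial.eval (z.2 : ℂ) (derivative S) * (r z.1 z.2 : ℂ) := by
      intro z
      unfold Jac
      rw [((hasDerivAt_poly α z.1).mul_const _).deriv, ((hasDerivAt_poly β z.2).const_mul _).deriv,
        ((hasDerivAt_poly ψ z.2).const_mul _).deriv, ((hasDerivAt_poly φ z.1).mul_const _).deriv,
        hG, hS]
      simp only [derivative_mul, eval_mul, eval_add]
      ring
    have hint := (integrableOn_poly hr _ (hcont (derivative G) (derivative (ψ * β)))).sub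
      (integrableOn_poly hr _ (hcont (derivative (α * φ)) (derivative S)))
    have hfin := setIntegral_prod (μ := (volume : Measure ℝ)) (ν := (volume : Measure ℝ)) _
      (by rw [← Measure.volume_eq_prod]; exact hint)
    rw [← Measure.volume_eq_prod] at hfin
    refine hfin.trans ?_
    refine integral_congr_ae (Filter.Eventually.of_forall fun t => ?_)
    refine integral_congr_ae (Filter.Eventually.of_forall fun l => ?_)
    exact (hJ (t, l)).symm

end HHCP
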